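/- There is a universal constant C > 0 with the following property. Let u : ℝ → ℝ be a Schwartz function satisfying ‖u‖_{Ḃ^{-1/2}_{2,∞}} + ‖Lu‖_{Ḣ^{1/2}} ≤ 1, where Lu(x) := x·u(x) - 3u''(x). Then for every R ≥ 1, with A_R := { x ∈ ℝ : R ≤ (x²+1)^{1/2} ≤ 2R }, one has ‖u‖_{L²(A_R)} ≤ C·R^{1/4}, ‖u'‖_{L²(A_R)} ≤ C·R^{3/4}, and ‖u''‖_{L²(A_R)} ≤ C·R^{5/4}. -/

import Mathlib

open MeasureTheory Real SchwartzMap Set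
open scoped FourierTransform

noncomputable section

/-- Fourier transform of a real-valued function on `ℝ`. -/
def FT (u : ℝ → ℝ) : ℝ → ℂ := 𝓕 (fun x => (u x : ℂ))

/-- Homogeneous Sobolev norm `‖u‖_{Ḣˢ}`. -/
def HsNorm (s : ℝ) (u : ℝ → ℝ) : ℝ :=
  (∫ ξ : ℝ, |ξ| ^ (2 * s) * ‖FT u ξ‖ ^ 2) ^ (1/2 : ℝ)

/-- Homogeneous Besov norm `‖u‖_{Ḃ^{-1/2}_{2,∞}}`. -/
def BesovNorm (u : ℝ → ℝ) : ℝ :=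
  ⨆ j : ℤ, (2:ℝ) ^ (-(j:ℝ)/2) *
    (∫ ξ in {ξ : ℝ | (2:ℝ)^j ≤ |ξ| ∧ |ξ| < (2:ℝ)^(j+1)}, ‖FT u ξ‖^2) ^ (1/2:ℝ)

/-- `L²` norm. -/
def L2Norm (u : ℝ → ℝ) : ℝ := (∫ x : ℝ, u x ^ 2) ^ (1/2:ℝ)

/-- `L²` norm restricted to a set. -/
def L2NormOn (A : Set ℝ) (u : ℝ → ℝ) : ℝ := (∫ x in A, u x ^ 2) ^ (1/2:ℝ)

/-- The time-dependent japanese bracket `⟨x⟩ = (x² + t^{2/3})^{1/2}`. -/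
def jb (t x : ℝ) : ℝ := (x^2 + t ^ ((2:ℝ)/3)) ^ (1/2:ℝ)

/-- The operator `Lu = xu - 3u''` (time `t = 1` normalization). -/
def Lop (u : ℝ → ℝ) : ℝ → ℝ := fun x => x * u x - 3 * iteratedDeriv 2 u x

/-- The dyadic region `A_R = {x : R ≤ (x²+1)^{1/2} ≤ 2R}`. -/
def AR (R : ℝ) : Set ℝ :=
  {x : ℝ | R ≤ (x^2 + 1) ^ ((1:ℝ)/2) ∧ (x^2 + 1) ^ ((1:ℝ)/2) ≤ 2 * R}

open LineDeriv

lemma integrable_norm_sq_schwartz (g : 𝓢(ℝ, ℂ)) : Integrable fun x => ‖g x‖ ^ 2 := by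
  simpa using (g.memLp 2 volume).integrable_norm_pow (by norm_num)

lemma integral_norm_sq_fourierInv (g : 𝓢(ℝ, ℂ)) : ∫ x, ‖𝓕⁻ g x‖ ^ 2 = ∫ ξ, ‖g ξ‖ ^ 2 := by
  rw [← integral_norm_sq_fourier (𝓕⁻ g), FourierTransform.fourier_fourierInv_eq]

lemma setIntegral_norm_sq_fourierInv_le (A : Set ℝ) (g : 𝓢(ℝ, ℂ)) :
    ∫ x in A, ‖𝓕⁻ g x‖ ^ 2 ≤ ∫ ξ, ‖g ξ‖ ^ 2 := by
  rw [← integral_norm_sq_fourierInv]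
  exact setIntegral_le_integral (integrable_norm_sq_schwartz _) (ae_of_all _ fun _ => by positivity)

lemma lineDerivOp_one_apply (g : 𝓢(ℝ, ℂ)) (x : ℝ) : ∂_{(1 : ℝ)} g x = deriv g x := by
  rw [lineDerivOp_apply_eq_fderiv, fderiv_apply_one_eq_deriv]

lemma hasTemperateGrowth_inv_one_add_sq :
    Function.HasTemperateGrowth fun t : ℝ => (1 + t ^ 2)⁻¹ := by
  have := Function.hasTemperateGrowth_one_add_norm_sq_rpow ℝ (-1)
  simpa [Real.rpow_neg_one] using this

lemma Function.HasTemperateGrowth.comp_div_const {a : ℝ → ℝ} (ha : a.HasTemperateGrowth) (N : ℝ) :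
    Function.HasTemperateGrowth fun ξ => a (ξ / N) := by
  have : Function.HasTemperateGrowth fun ξ : ℝ => ξ / N := by
    simp only [div_eq_mul_inv]; fun_prop
  exact ha.comp this

/-- The dilated symbol `a(ξ / N)` applied to a Schwartz function. -/
def dilSymbol (N : ℝ) (a : ℝ → ℝ) (f : 𝓢(ℝ, ℂ)) : 𝓢(ℝ, ℂ) :=
  smulLeftCLM ℂ (fun ξ => a (ξ / N)) f

lemma dilSymbol_apply {a : ℝ → ℝ} (ha : a.HasTemperateGrowth) (N : ℝ) (f : 𝓢(ℝ, ℂ)) (ξ : ℝ) :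
    dilSymbol N a f ξ = (a (ξ / N) : ℂ) * f ξ := by
  simp [dilSymbol, smulLeftCLM_apply_apply (ha.comp_div_const N)]

lemma fourierInv_lineDerivOp_one_apply (g : 𝓢(ℝ, ℂ)) (x : ℝ) :
    𝓕⁻ (∂_{(1 : ℝ)} g) x = -(2 * π * Complex.I) * (x * 𝓕⁻ g x) := by
  rw [fourierInv_lineDerivOp_eq]
  have : Function.HasTemperateGrowth fun x : ℝ => x := by fun_prop
  simp [smulLeftCLM_apply_apply this]

lemma fourierInv_dilSymbol {f h : 𝓢(ℝ, ℂ)}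
    (hode : ∀ ξ : ℝ, h ξ = Complex.I / (2 * π) * deriv f ξ + 12 * π ^ 2 * ξ ^ 2 * f ξ)
    {N : ℝ} (hN : 1 ≤ N) {α σ σ' : ℝ → ℝ} (hα : α.HasTemperateGrowth) (hσ : σ.HasTemperateGrowth)
    (hσ' : σ'.HasTemperateGrowth) (hd : ∀ t, HasDerivAt σ (σ' t) t) (x : ℝ) :
    𝓕⁻ (dilSymbol N (fun t => α t + t ^ 2 * σ t) f) x = 𝓕⁻ (dilSymbol N α f) x +
      (1 / (12 * π ^ 2 * N ^ 2) : ℂ) * (𝓕⁻ (dilSymbol N σ h) x - x * 𝓕⁻ (dilSymbol N σ f) x +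
        Complex.I / (2 * π * N) * 𝓕⁻ (dilSymbol N σ' f) x) := by
  have hN0 : (N : ℂ) ≠ 0 := by exact_mod_cast (by positivity : N ≠ 0)
  have hπ : (π : ℂ) ≠ 0 := by exact_mod_cast Real.pi_ne_zero
  have key : dilSymbol N (fun t => α t + t ^ 2 * σ t) f = dilSymbol N α f +
      (1 / (12 * π ^ 2 * N ^ 2) : ℂ) • (dilSymbol N σ h -
        (Complex.I / (2 * π)) • ∂_{(1 : ℝ)} (dilSymbol N σ f) +
        (Complex.I / (2 * π * N)) • dilSymbol N σ' f) := by
    ext ξ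
    have hder : deriv (dilSymbol N σ f) ξ =
        (σ' (ξ / N) / N : ℂ) * f ξ + (σ (ξ / N) : ℂ) * deriv f ξ := by
      have h1 : HasDerivAt (fun ξ : ℝ => (σ (ξ / N) : ℂ)) ((σ' (ξ / N) / N : ℝ) : ℂ) ξ := by
        have := (hd (ξ / N)).comp ξ ((hasDerivAt_id ξ).div_const N)
        simpa [Function.comp_def, div_eq_mul_inv] using this.ofReal_comp
      have h2 := h1.mul (f.hasDerivAt ξ)
      have h3 : ⇑(dilSymbol N σ f) = (fun ξ : ℝ => (σ (ξ / N) : ℂ)) * ⇑f := by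
        ext y; simp [dilSymbol_apply hσ]
      rw [h3, h2.deriv]; simp
    simp only [add_apply, sub_apply, smul_apply, lineDerivOp_one_apply, hder, smul_eq_mul,
      dilSymbol_apply hα, dilSymbol_apply hσ, dilSymbol_apply hσ', hode]
    rw [dilSymbol_apply (by fun_prop)]
    push_cast
    field_simp
    ring
  rw [key]
  simp only [FourierTransform.fourierInv_add, FourierTransform.fourierInv_smul,
    sub_eq_add_neg, ← neg_smul,
    add_apply, smul_apply, fourierInv_lineDerivOp_one_apply, smul_eq_mul]
  field_simp
  linear_combination (2 * π * N * x * 𝓕⁻ (dilSymbol N σ f) x) * Complex.I_sq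

lemma integrable_abs_mul_norm_sq_schwartz (h : 𝓢(ℝ, ℂ)) :
    Integrable fun ξ : ℝ => |ξ| * ‖h ξ‖ ^ 2 := by
  refine ((integrable_norm_sq_schwartz h).add
    (integrable_norm_sq_schwartz (smulLeftCLM ℂ (fun ξ : ℝ => ξ) h))).mono'
    (by fun_prop) (ae_of_all _ fun ξ => ?_)
  have hid : Function.HasTemperateGrowth fun x : ℝ => x := by fun_prop
  simp only [Pi.add_apply, smulLeftCLM_apply_apply hid, norm_smul, Real.norm_eq_abs, mul_pow,
    abs_mul, abs_abs, abs_pow, abs_norm]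
  nlinarith [sq_nonneg ‖h ξ‖, sq_nonneg (|ξ| - 1),
    mul_nonneg (sq_nonneg ‖h ξ‖) (sq_nonneg (|ξ| - 1)),
    mul_nonneg (sq_nonneg ‖h ξ‖) (sq_nonneg |ξ|)]

lemma integral_norm_sq_dilSymbol_le {f : 𝓢(ℝ, ℂ)} (hf : ∀ ξ, ‖f ξ‖ ≤ 8) {N : ℝ} (hN : 1 ≤ N)
    {a : ℝ → ℝ} (ha : a.HasTemperateGrowth) (hab : ∀ t, a t ^ 2 ≤ 9 * (1 + t ^ 2)⁻¹) :
    ∫ ξ, ‖dilSymbol N a f ξ‖ ^ 2 ≤ 2000 * N := by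
  have hN0 : 0 < N := by positivity
  have hi : Integrable fun ξ : ℝ => 576 * (1 + (ξ / N) ^ 2)⁻¹ :=
    (integrable_inv_one_add_sq.comp_div hN0.ne').const_mul 576
  calc ∫ ξ, ‖dilSymbol N a f ξ‖ ^ 2 ≤ ∫ ξ : ℝ, 576 * (1 + (ξ / N) ^ 2)⁻¹ := by
        refine integral_mono (integrable_norm_sq_schwartz _) hi fun ξ => ?_
        simp only [dilSymbol_apply ha, norm_mul, Complex.norm_real, Real.norm_eq_abs, mul_pow,
          sq_abs]
        calc a (ξ / N) ^ 2 * ‖f ξ‖ ^ 2 ≤ (9 * (1 + (ξ / N) ^ 2)⁻¹) * 8 ^ 2 := by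
              gcongr
              exacts [hab _, hf ξ]
          _ = _ := by ring
    _ = 576 * (N * π) := by
        rw [integral_const_mul, Measure.integral_comp_div (fun t : ℝ => (1 + t ^ 2)⁻¹),
          integral_univ_inv_one_add_sq, abs_of_pos hN0, smul_eq_mul]
    _ ≤ 2000 * N := by nlinarith [Real.pi_lt_d2]

lemma integral_norm_sq_dilSymbol_le_of_weighted {h : 𝓢(ℝ, ℂ)}
    (hh : ∫ ξ : ℝ, |ξ| * ‖h ξ‖ ^ 2 ≤ 1) {N : ℝ} (hN : 1 ≤ N)
    {a : ℝ → ℝ} (ha : a.HasTemperateGrowth) (hab : ∀ t, a t ^ 2 ≤ 9 * |t|) :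
    ∫ ξ, ‖dilSymbol N a h ξ‖ ^ 2 ≤ 9 * N := by
  have hN0 : 0 < N := by positivity
  calc ∫ ξ, ‖dilSymbol N a h ξ‖ ^ 2 ≤ ∫ ξ : ℝ, 9 / N * (|ξ| * ‖h ξ‖ ^ 2) := by
        refine integral_mono (integrable_norm_sq_schwartz _)
          ((integrable_abs_mul_norm_sq_schwartz h).const_mul _) fun ξ => ?_
        simp only [dilSymbol_apply ha, norm_mul, Complex.norm_real, Real.norm_eq_abs, mul_pow,
          sq_abs]
        calc a (ξ / N) ^ 2 * ‖h ξ‖ ^ 2 ≤ (9 * |ξ / N|) * ‖h ξ‖ ^ 2 := by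
              gcongr
              exact hab _
          _ = _ := by rw [abs_div, abs_of_pos hN0]; ring
    _ ≤ 9 / N * 1 := by
        rw [integral_const_mul]
        gcongr
    _ ≤ 9 * N := by
        rw [mul_one, div_le_iff₀ hN0]
        nlinarith

lemma setIntegral_norm_sq_fourierInv_dilSymbol_le {f h : 𝓢(ℝ, ℂ)}
    (hode : ∀ ξ : ℝ, h ξ = Complex.I / (2 * π) * deriv f ξ + 12 * π ^ 2 * ξ ^ 2 * f ξ)
    (hf : ∀ ξ, ‖f ξ‖ ≤ 8) (hh : ∫ ξ : ℝ, |ξ| * ‖h ξ‖ ^ 2 ≤ 1)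
    {N : ℝ} (hN : 1 ≤ N) {A : Set ℝ} (hAm : MeasurableSet A) (hA : ∀ x ∈ A, |x| ≤ 2 * N ^ 2)
    {α σ σ' : ℝ → ℝ} (hα : α.HasTemperateGrowth) (hσ : σ.HasTemperateGrowth)
    (hσ' : σ'.HasTemperateGrowth) (hd : ∀ t, HasDerivAt σ (σ' t) t)
    (hαb : ∀ t, α t ^ 2 ≤ 9 * (1 + t ^ 2)⁻¹) (hσb : ∀ t, σ t ^ 2 ≤ 9 * |t|)
    (hσb' : ∀ t, σ' t ^ 2 ≤ 9 * (1 + t ^ 2)⁻¹) {K : ℝ}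
    (hK : ∫ x in A, ‖𝓕⁻ (dilSymbol N σ f) x‖ ^ 2 ≤ K * N) :
    ∫ x in A, ‖𝓕⁻ (dilSymbol N (fun t => α t + t ^ 2 * σ t) f) x‖ ^ 2 ≤
      (16036 + 16 * K) * N := by
  have hN0 : 0 < N := by positivity
  have hpt : ∀ x ∈ A, ‖𝓕⁻ (dilSymbol N (fun t => α t + t ^ 2 * σ t) f) x‖ ^ 2 ≤
      4 * ‖𝓕⁻ (dilSymbol N α f) x‖ ^ 2 + 4 * ‖𝓕⁻ (dilSymbol N σ h) x‖ ^ 2 +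
      16 * ‖𝓕⁻ (dilSymbol N σ f) x‖ ^ 2 + 4 * ‖𝓕⁻ (dilSymbol N σ' f) x‖ ^ 2 := by
    intro x hx
    have hπ := Real.pi_gt_three
    have h12 : N ^ 2 ≤ 12 * π ^ 2 * N ^ 2 :=
      le_mul_of_one_le_left (sq_nonneg N) (by nlinarith)
    have h1 : 1 ≤ 12 * π ^ 2 * N ^ 2 := by nlinarith
    have hc : ‖(1 / (12 * π ^ 2 * N ^ 2) : ℂ)‖ = 1 / (12 * π ^ 2 * N ^ 2) := by
      simp [abs_of_pos hN0, abs_of_pos Real.pi_pos]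
    have hc' : ‖(Complex.I / (2 * π * N) : ℂ)‖ = 1 / (2 * π * N) := by
      simp [abs_of_pos hN0, abs_of_pos Real.pi_pos]
    have h2 : 1 / (2 * π * N) ≤ 1 := by
      rw [div_le_one (by positivity)]; nlinarith
    have h3 : 1 / (12 * π ^ 2 * N ^ 2) ≤ 1 := by
      rwa [div_le_one (by positivity)]
    have h4 : 1 / (12 * π ^ 2 * N ^ 2) * |x| ≤ 2 := by
      rw [one_div_mul_eq_div, div_le_iff₀ (by positivity)]
      linarith [hA x hx]
    have hle : ‖𝓕⁻ (dilSymbol N (fun t => α t + t ^ 2 * σ t) f) x‖ ≤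
        ‖𝓕⁻ (dilSymbol N α f) x‖ + ‖𝓕⁻ (dilSymbol N σ h) x‖ +
        2 * ‖𝓕⁻ (dilSymbol N σ f) x‖ + ‖𝓕⁻ (dilSymbol N σ' f) x‖ := by
      rw [fourierInv_dilSymbol hode hN hα hσ hσ' hd]
      generalize 𝓕⁻ (dilSymbol N α f) x = a
      generalize 𝓕⁻ (dilSymbol N σ h) x = b
      generalize 𝓕⁻ (dilSymbol N σ f) x = c
      generalize 𝓕⁻ (dilSymbol N σ' f) x = d
      generalize (12 * π ^ 2 * N ^ 2 : ℝ) = M at *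
      refine (norm_add_le _ _).trans ?_
      rw [norm_mul, hc]
      have h5 : ‖b - x * c + Complex.I / (2 * π * N) * d‖ ≤ ‖b‖ + |x| * ‖c‖ + ‖d‖ := by
        refine (norm_add_le _ _).trans (add_le_add ((norm_sub_le _ _).trans_eq ?_) ?_)
        · simp
        · rw [norm_mul, hc']
          exact mul_le_of_le_one_left (norm_nonneg _) h2
      have h6 := mul_le_mul_of_nonneg_left h5 (by positivity : 0 ≤ 1 / M)
      have h7 := mul_le_mul_of_nonneg_right h4 (norm_nonneg c)
      have h8 := mul_le_mul_of_nonneg_right h3 (norm_nonneg b)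
      have h9 := mul_le_mul_of_nonneg_right h3 (norm_nonneg d)
      linarith
    generalize ‖𝓕⁻ (dilSymbol N α f) x‖ = a at *
    generalize ‖𝓕⁻ (dilSymbol N σ h) x‖ = b at *
    generalize ‖𝓕⁻ (dilSymbol N σ f) x‖ = c at *
    generalize ‖𝓕⁻ (dilSymbol N σ' f) x‖ = d at *
    refine (pow_le_pow_left₀ (norm_nonneg _) hle 2).trans ?_
    nlinarith [sq_nonneg (a - b), sq_nonneg (a - 2 * c), sq_nonneg (a - d),
      sq_nonneg (b - 2 * c), sq_nonneg (b - d), sq_nonneg (2 * c - d)]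
  have hI (g : 𝓢(ℝ, ℂ)) (k : ℝ) : IntegrableOn (fun x => k * ‖g x‖ ^ 2) A :=
    ((integrable_norm_sq_schwartz g).const_mul k).integrableOn
  have hmono := setIntegral_mono_on (integrable_norm_sq_schwartz _).integrableOn
    ((((hI _ 4).add (hI _ 4)).add (hI _ 16)).add (hI _ 4)) hAm hpt
  refine hmono.trans ?_
  rw [integral_add' (((hI _ 4).add (hI _ 4)).add (hI _ 16)) (hI _ 4),
    integral_add' ((hI _ 4).add (hI _ 4)) (hI _ 16), integral_add' (hI _ 4) (hI _ 4)]
  simp only [integral_const_mul]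
  have e1 := (setIntegral_norm_sq_fourierInv_le A _).trans
    (integral_norm_sq_dilSymbol_le hf hN hα hαb)
  have e2 := (setIntegral_norm_sq_fourierInv_le A _).trans
    (integral_norm_sq_dilSymbol_le_of_weighted hh hN hσ hσb)
  have e3 := (setIntegral_norm_sq_fourierInv_le A _).trans
    (integral_norm_sq_dilSymbol_le hf hN hσ' hσb')
  linarith

lemma norm_le_of_hasDerivAt_airy {f h : 𝓢(ℝ, ℂ)}
    (hode : ∀ ξ : ℝ, h ξ = Complex.I / (2 * π) * deriv f ξ + 12 * π ^ 2 * ξ ^ 2 * f ξ)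
    (hh : ∫ ξ : ℝ, |ξ| * ‖h ξ‖ ^ 2 ≤ 1) {S : Set ℝ} (hS : MeasurableSet S) [S.OrdConnected]
    {r : ℝ} (hr : 0 < r) (hvol : volume S = ENNReal.ofReal r) (hSr : ∀ ξ ∈ S, r ≤ |ξ|)
    (hf : ∫ ξ in S, ‖f ξ‖ ^ 2 ≤ r) {ξ : ℝ} (hξ : ξ ∈ S) : ‖f ξ‖ ≤ 8 := by
  have hreal : volume.real S = r := by simp [Measure.real, hvol, hr.le]
  have hfin : volume S ≠ ⊤ := by simp [hvol]
  obtain ⟨η, hη, hfη⟩ : ∃ η ∈ S, ‖f η‖ ≤ 1 := by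
    obtain ⟨η, hη, hle⟩ := exists_le_setAverage (μ := volume) (s := S) (by simpa [hvol] using hr)
      hfin (integrable_norm_sq_schwartz f).integrableOn
    refine ⟨η, hη, ?_⟩
    rw [setAverage_eq, hreal, smul_eq_mul] at hle
    have : r⁻¹ * ∫ ξ in S, ‖f ξ‖ ^ 2 ≤ 1 := by
      rw [inv_mul_le_iff₀ hr]; linarith
    nlinarith [norm_nonneg (f η)]
  have hhI : Integrable fun x => ‖h x‖ := (h.integrable (μ := volume)).norm
  have hhS : ∫ x in S, ‖h x‖ ≤ 1 := by
    have hI : IntegrableOn (fun x : ℝ => 1 / 2 * (|x| * ‖h x‖ ^ 2)) S :=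
      ((integrable_abs_mul_norm_sq_schwartz h).const_mul _).integrableOn
    have hI' : IntegrableOn (fun _ : ℝ => 1 / 2 * r⁻¹) S := integrableOn_const hfin
    calc ∫ x in S, ‖h x‖ ≤ ∫ x in S, (1 / 2 * (|x| * ‖h x‖ ^ 2) + 1 / 2 * r⁻¹) := by
          refine setIntegral_mono_on hhI.integrableOn (hI.add hI') hS fun x hx => ?_
          have h1 := mul_le_mul_of_nonneg_right (hSr x hx) (sq_nonneg ‖h x‖)
          have h2 : r * ‖h x‖ ^ 2 + r⁻¹ - 2 * ‖h x‖ = r⁻¹ * (r * ‖h x‖ - 1) ^ 2 := by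
            field_simp; ring
          have h3 : 0 ≤ r⁻¹ * (r * ‖h x‖ - 1) ^ 2 := by positivity
          linarith
      _ = 1 / 2 * (∫ x in S, |x| * ‖h x‖ ^ 2) + 1 / 2 := by
          rw [integral_add hI hI', integral_const_mul, setIntegral_const, hreal, smul_eq_mul]
          field_simp
      _ ≤ 1 := by
          have := setIntegral_le_integral (s := S) (integrable_abs_mul_norm_sq_schwartz h)
            (ae_of_all _ fun _ => by positivity)
          linarith
  set F : ℝ → ℂ := fun x => Complex.exp (((-(8 * π ^ 3 * x ^ 3) : ℝ) : ℂ) * Complex.I) * f x with hF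
  have hnorm (x : ℝ) : ‖F x‖ = ‖f x‖ := by
    simp only [hF, norm_mul, Complex.norm_exp_ofReal_mul_I, one_mul]
  set G : ℝ → ℂ := fun x => -(2 * π * Complex.I) *
    (Complex.exp (((-(8 * π ^ 3 * x ^ 3) : ℝ) : ℂ) * Complex.I) * h x) with hG
  have hGnorm (x : ℝ) : ‖G x‖ = 2 * π * ‖h x‖ := by
    simp only [hG, norm_mul, Complex.norm_exp_ofReal_mul_I, one_mul, norm_neg, Complex.norm_I]
    simp [abs_of_pos Real.pi_pos]
  have hFG (x : ℝ) : HasDerivAt F (G x) x := by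
    have h1 : HasDerivAt (fun x : ℝ => -(8 * π ^ 3 * x ^ 3)) (-(8 * π ^ 3 * (3 * x ^ 2))) x := by
      simpa using ((hasDerivAt_pow 3 x).const_mul (8 * π ^ 3)).fun_neg
    have h2 := ((h1.ofReal_comp.mul_const Complex.I).cexp).mul (f.hasDerivAt x)
    refine h2.congr_deriv ?_
    have hπ : (π : ℂ) ≠ 0 := by exact_mod_cast Real.pi_ne_zero
    simp only [hG, hode]
    push_cast
    field_simp
    linear_combination deriv f x * Complex.I_sq
  have hGc : Continuous G := by
    have := h.continuous
    fun_prop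
  have hsub : F ξ - F η = ∫ x in η..ξ, G x :=
    (intervalIntegral.integral_eq_sub_of_hasDerivAt (fun x _ => hFG x)
      (hGc.intervalIntegrable _ _)).symm
  have hdiff : ‖F ξ - F η‖ ≤ 2 * π := by
    rw [hsub]
    refine intervalIntegral.norm_integral_le_integral_norm_uIoc.trans ?_
    simp only [hGnorm]
    calc ∫ x in uIoc η ξ, 2 * π * ‖h x‖ ≤ ∫ x in S, 2 * π * ‖h x‖ :=
          setIntegral_mono_set (hhI.const_mul _).integrableOn
            (ae_of_all _ fun _ => by positivity)
            (uIoc_subset_uIcc.trans (Set.OrdConnected.uIcc_subset ‹_› hη hξ)).eventuallyLE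
      _ = 2 * π * ∫ x in S, ‖h x‖ := integral_const_mul _ _
      _ ≤ 2 * π * 1 := by gcongr
      _ = 2 * π := mul_one _
  have htri : ‖F ξ‖ ≤ ‖F η‖ + ‖F ξ - F η‖ := by
    simpa using norm_add_le (F η) (F ξ - F η)
  rw [hnorm, hnorm] at htri
  linarith [Real.pi_lt_d2]

lemma norm_le_of_dyadic {f h : 𝓢(ℝ, ℂ)}
    (hode : ∀ ξ : ℝ, h ξ = Complex.I / (2 * π) * deriv f ξ + 12 * π ^ 2 * ξ ^ 2 * f ξ)
    (hh : ∫ ξ : ℝ, |ξ| * ‖h ξ‖ ^ 2 ≤ 1)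
    (hf : ∀ j : ℤ, ∫ ξ in {ξ : ℝ | (2 : ℝ) ^ j ≤ |ξ| ∧ |ξ| < (2 : ℝ) ^ (j + 1)}, ‖f ξ‖ ^ 2 ≤
      (2 : ℝ) ^ j) (ξ : ℝ) : ‖f ξ‖ ≤ 8 := by
  suffices hne : ({0}ᶜ : Set ℝ) ⊆ {ξ | ‖f ξ‖ ≤ 8} by
    have hcl : IsClosed {ξ : ℝ | ‖f ξ‖ ≤ 8} :=
      isClosed_le f.continuous.norm continuous_const
    have := hcl.closure_subset_iff.2 hne
    rw [(dense_compl_singleton (0 : ℝ)).closure_eq] at this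
    exact this (mem_univ ξ)
  intro ξ (hξ : ξ ≠ 0)
  obtain ⟨j, hj⟩ := exists_mem_Ico_zpow (abs_pos.2 hξ) (one_lt_two (α := ℝ))
  have hpos : (0 : ℝ) < 2 ^ j := by positivity
  have hsucc : (2 : ℝ) ^ (j + 1) = 2 * 2 ^ j := by rw [zpow_add_one₀ two_ne_zero]; ring
  have hmono {S : Set ℝ} (hsub : S ⊆ {ξ : ℝ | (2 : ℝ) ^ j ≤ |ξ| ∧ |ξ| < (2 : ℝ) ^ (j + 1)}) :
      ∫ ξ in S, ‖f ξ‖ ^ 2 ≤ (2 : ℝ) ^ j :=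
    (setIntegral_mono_set (integrable_norm_sq_schwartz f).integrableOn
      (ae_of_all _ fun _ => by positivity) hsub.eventuallyLE).trans (hf j)
  rcases hξ.lt_or_gt with hneg | hpos'
  · rw [abs_of_neg hneg] at hj
    have hsub : Ioc (-(2 : ℝ) ^ (j + 1)) (-(2 : ℝ) ^ j) ⊆
        {ξ : ℝ | (2 : ℝ) ^ j ≤ |ξ| ∧ |ξ| < (2 : ℝ) ^ (j + 1)} := by
      intro x hx
      have : x < 0 := by linarith [hx.2]
      simp only [mem_ofPred_eq, abs_of_neg this]
      constructor <;> linarith [hx.1, hx.2]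
    refine norm_le_of_hasDerivAt_airy hode hh measurableSet_Ioc hpos ?_ (fun x hx => (hsub hx).1)
      (hmono hsub) (⟨by linarith [hj.2], by linarith [hj.1]⟩ : ξ ∈ Ioc (-(2 : ℝ) ^ (j + 1)) _)
    rw [Real.volume_Ioc, hsucc]; ring_nf
  · rw [abs_of_pos hpos'] at hj
    have hsub : Ico ((2 : ℝ) ^ j) ((2 : ℝ) ^ (j + 1)) ⊆
        {ξ : ℝ | (2 : ℝ) ^ j ≤ |ξ| ∧ |ξ| < (2 : ℝ) ^ (j + 1)} := by
      intro x hx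
      rwa [mem_ofPred_eq, abs_of_pos (hpos.trans_le hx.1)]
    refine norm_le_of_hasDerivAt_airy hode hh measurableSet_Ico hpos ?_ (fun x hx => (hsub hx).1)
      (hmono hsub) hj
    rw [Real.volume_Ico, hsucc]; ring_nf

/-- The complexification of a real-valued Schwartz function. -/
def cplx (u : 𝓢(ℝ, ℝ)) : 𝓢(ℝ, ℂ) := postcompCLM Complex.ofRealCLM u

lemma cplx_apply (u : 𝓢(ℝ, ℝ)) (x : ℝ) : cplx u x = (u x : ℂ) := rfl

lemma lineDerivOp_one_cplx (u : 𝓢(ℝ, ℝ)) : ∂_{(1 : ℝ)} (cplx u) = cplx (derivCLM ℝ ℝ u) := by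
  ext x
  rw [lineDerivOp_one_apply, cplx_apply, derivCLM_apply]
  exact (u.hasDerivAt x).ofReal_comp.deriv

lemma coe_derivCLM_derivCLM (u : 𝓢(ℝ, ℝ)) :
    ⇑(derivCLM ℝ ℝ (derivCLM ℝ ℝ u)) = iteratedDeriv 2 u := by
  have (v : 𝓢(ℝ, ℝ)) : ⇑(derivCLM ℝ ℝ v) = deriv v := funext fun x => derivCLM_apply ℝ v x
  rw [this, this, iteratedDeriv_succ, iteratedDeriv_one]

/-- The complexification of `x u - 3 u''` as a Schwartz function. -/
def cplxLop (u : 𝓢(ℝ, ℝ)) : 𝓢(ℝ, ℂ) :=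
  smulLeftCLM ℂ (fun x : ℝ => x) (cplx u) - (3 : ℂ) • ∂_{(1 : ℝ)} (∂_{(1 : ℝ)} (cplx u))

lemma cplxLop_apply (u : 𝓢(ℝ, ℝ)) (x : ℝ) : cplxLop u x = (Lop u x : ℂ) := by
  have hid : Function.HasTemperateGrowth fun x : ℝ => x := by fun_prop
  rw [Lop, ← coe_derivCLM_derivCLM]
  simp [cplxLop, lineDerivOp_one_cplx, smulLeftCLM_apply_apply hid, cplx_apply]

lemma FT_eq_fourier_cplx (u : 𝓢(ℝ, ℝ)) : FT u = 𝓕 (cplx u) := rfl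

lemma FT_Lop_eq_fourier_cplxLop (u : 𝓢(ℝ, ℝ)) : FT (Lop u) = 𝓕 (cplxLop u) := by
  have : (fun x => (Lop u x : ℂ)) = cplxLop u := funext fun x => (cplxLop_apply u x).symm
  rw [FT, this, fourier_coe]

lemma fourier_lineDerivOp_one_apply (g : 𝓢(ℝ, ℂ)) (ξ : ℝ) :
    𝓕 (∂_{(1 : ℝ)} g) ξ = 2 * π * Complex.I * (ξ * 𝓕 g ξ) := by
  rw [fourier_lineDerivOp_eq]
  have : Function.HasTemperateGrowth fun x : ℝ => x := by fun_prop
  simp [smulLeftCLM_apply_apply this]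

lemma fourier_cplxLop (u : 𝓢(ℝ, ℝ)) (ξ : ℝ) :
    𝓕 (cplxLop u) ξ = Complex.I / (2 * π) * deriv (𝓕 (cplx u) : 𝓢(ℝ, ℂ)) ξ +
      12 * π ^ 2 * ξ ^ 2 * 𝓕 (cplx u) ξ := by
  have hπ : (π : ℂ) ≠ 0 := by exact_mod_cast Real.pi_ne_zero
  have hd : deriv (𝓕 (cplx u) : 𝓢(ℝ, ℂ)) ξ =
      -(2 * π * Complex.I) * 𝓕 (smulLeftCLM ℂ (fun x : ℝ => x) (cplx u)) ξ := by
    rw [← lineDerivOp_one_apply, lineDerivOp_fourier_eq, FourierTransform.fourier_smul]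
    simp
  rw [hd, cplxLop, sub_eq_add_neg, ← neg_smul, FourierTransform.fourier_add,
    FourierTransform.fourier_smul]
  simp only [add_apply, smul_apply, fourier_lineDerivOp_one_apply, smul_eq_mul]
  field_simp
  linear_combination (𝓕 (smulLeftCLM ℂ (fun x : ℝ => x) (cplx u)) ξ -
    12 * π ^ 2 * ξ ^ 2 * 𝓕 (cplx u) ξ) * Complex.I_sq

lemma lineDerivOp_one_fourierInv_dilSymbol_pow {N : ℝ} (hN : N ≠ 0) (k : ℕ) (f : 𝓢(ℝ, ℂ)) :
    ∂_{(1 : ℝ)} (𝓕⁻ (dilSymbol N (fun t => t ^ k) f)) =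
      (2 * π * Complex.I * N) • 𝓕⁻ (dilSymbol N (fun t => t ^ (k + 1)) f) := by
  rw [lineDerivOp_fourierInv_eq, ← FourierTransform.fourierInv_smul]
  congr 1
  ext ξ
  have hid : Function.HasTemperateGrowth fun x : ℝ => x := by fun_prop
  have hN' : (N : ℂ) ≠ 0 := by exact_mod_cast hN
  have h1 : dilSymbol N (fun t => t ^ k) f ξ = _ := dilSymbol_apply (by fun_prop) N f ξ
  have h2 : dilSymbol N (fun t => t ^ (k + 1)) f ξ = _ := dilSymbol_apply (by fun_prop) N f ξ
  have h3 : smulLeftCLM ℂ (fun x : ℝ => inner ℝ x 1) (dilSymbol N (fun t => t ^ k) f) ξ =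
      ξ * dilSymbol N (fun t => t ^ k) f ξ := by
    simp [smulLeftCLM_apply_apply hid]
  simp only [smul_apply, h2, h3, h1, smul_eq_mul]
  push_cast
  rw [pow_succ]
  field_simp

lemma fourierInv_dilSymbol_pow_zero (N : ℝ) (v : 𝓢(ℝ, ℂ)) :
    𝓕⁻ (dilSymbol N (fun t => t ^ 0) (𝓕 v)) = v := by
  have : dilSymbol N (fun t => t ^ 0) (𝓕 v) = 𝓕 v := by
    ext ξ
    rw [dilSymbol_apply (by fun_prop)]
    simp
  rw [this, FourierTransform.fourierInv_fourier_eq]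

lemma setIntegral_sq_eq_norm_cplx (A : Set ℝ) (v : 𝓢(ℝ, ℝ)) :
    ∫ x in A, v x ^ 2 = ∫ x in A, ‖cplx v x‖ ^ 2 := by
  simp [cplx_apply]

lemma setIntegral_norm_sq_smul (A : Set ℝ) (c : ℂ) (g : 𝓢(ℝ, ℂ)) :
    ∫ x in A, ‖(c • g) x‖ ^ 2 = ‖c‖ ^ 2 * ∫ x in A, ‖g x‖ ^ 2 := by
  simp [mul_pow, integral_const_mul]

lemma hasDerivAt_inv_one_add_sq (t : ℝ) :
    HasDerivAt (fun t : ℝ => (1 + t ^ 2)⁻¹) (-2 * t * (1 + t ^ 2)⁻¹ ^ 2) t := by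
  refine ((((hasDerivAt_id t).pow 2).const_add 1).inv (by simp; positivity)).congr_deriv ?_
  simp; ring

lemma exists_inv_one_add_sq (t : ℝ) :
    ∃ b, (1 + t ^ 2)⁻¹ = b ∧ 0 < b ∧ b ≤ 1 ∧ t ^ 2 * b = 1 - b ∧ |t| * b ≤ 1 := by
  refine ⟨_, rfl, by positivity, inv_le_one_of_one_le₀ (by nlinarith [sq_nonneg t]),
    by field_simp; ring, ?_⟩
  rw [← div_eq_mul_inv, div_le_one (by positivity)]
  nlinarith [sq_abs t, sq_nonneg (|t| - 1)]

lemma mul_inv_one_add_sq_sq_sq_le (t : ℝ) :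
    (t ^ 2 * (1 + t ^ 2)⁻¹ ^ 2) ^ 2 ≤ 9 * (1 + t ^ 2)⁻¹ := by
  obtain ⟨b, hb, hb0, hb1, htb, -⟩ := exists_inv_one_add_sq t
  rw [hb]
  calc (t ^ 2 * b ^ 2) ^ 2 = (1 - b) ^ 2 * b * b := by rw [← htb]; ring
    _ ≤ 1 ^ 2 * 1 * b := by gcongr; linarith
    _ ≤ 9 * b := by linarith

lemma mul_inv_one_add_sq_sq_le (t : ℝ) :
    (t * (1 + t ^ 2)⁻¹) ^ 2 ≤ 9 * (1 + t ^ 2)⁻¹ := by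
  obtain ⟨b, hb, hb0, hb1, htb, -⟩ := exists_inv_one_add_sq t
  rw [hb]
  calc (t * b) ^ 2 = (1 - b) * b := by rw [← htb]; ring
    _ ≤ 9 * b := by gcongr; linarith

lemma setIntegral_norm_sq_fourierInv_dilSymbol_pow_zero_le {f h : 𝓢(ℝ, ℂ)}
    (hode : ∀ ξ : ℝ, h ξ = Complex.I / (2 * π) * deriv f ξ + 12 * π ^ 2 * ξ ^ 2 * f ξ)
    (hf : ∀ ξ, ‖f ξ‖ ≤ 8) (hh : ∫ ξ : ℝ, |ξ| * ‖h ξ‖ ^ 2 ≤ 1)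
    {N : ℝ} (hN : 1 ≤ N) {A : Set ℝ} (hAm : MeasurableSet A) (hA : ∀ x ∈ A, |x| ≤ 2 * N ^ 2) :
    ∫ x in A, ‖𝓕⁻ (dilSymbol N (fun t => t ^ 0) f) x‖ ^ 2 ≤ 50000 * N := by
  have hb := hasTemperateGrowth_inv_one_add_sq
  have hα : Function.HasTemperateGrowth fun t : ℝ => (1 + 2 * t ^ 2) * (1 + t ^ 2)⁻¹ ^ 2 := by
    fun_prop
  have hσ : Function.HasTemperateGrowth fun t : ℝ => t ^ 2 * (1 + t ^ 2)⁻¹ ^ 2 := by fun_prop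
  have hσ' : Function.HasTemperateGrowth fun t : ℝ =>
      2 * t * (1 + t ^ 2)⁻¹ ^ 2 - 4 * t ^ 3 * (1 + t ^ 2)⁻¹ ^ 3 := by fun_prop
  have hd (t : ℝ) := ((hasDerivAt_id t).pow 2).mul ((hasDerivAt_inv_one_add_sq t).pow 2)
  have key := setIntegral_norm_sq_fourierInv_dilSymbol_le hode hf hh hN hAm hA hα hσ hσ'
    (fun t => (hd t).congr_deriv ?_) (fun t => ?_) (fun t => ?_) (fun t => ?_)
    ((setIntegral_norm_sq_fourierInv_le A _).trans
      (integral_norm_sq_dilSymbol_le hf hN hσ mul_inv_one_add_sq_sq_sq_le))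
  · have : (fun t : ℝ => (1 + 2 * t ^ 2) * (1 + t ^ 2)⁻¹ ^ 2 +
        t ^ 2 * (t ^ 2 * (1 + t ^ 2)⁻¹ ^ 2)) = fun t => t ^ 0 := by
      ext t
      field_simp
      ring
    rw [this] at key
    linarith
  · simp [-inv_pow]
    generalize (1 + t ^ 2)⁻¹ = b
    ring
  all_goals
    obtain ⟨b, hb, hb0, hb1, htb, htb'⟩ := exists_inv_one_add_sq t
    rw [hb]
  · calc ((1 + 2 * t ^ 2) * b ^ 2) ^ 2 = ((2 - b) ^ 2 * b) * b := by
          have : (1 + 2 * t ^ 2) * b = 2 - b := by linear_combination 2 * htb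
          rw [← this]; ring
      _ ≤ (2 ^ 2 * 1) * b := by gcongr <;> linarith
      _ ≤ 9 * b := by linarith
  · calc (t ^ 2 * b ^ 2) ^ 2 = (|t| * b) ^ 3 * b * |t| := by rw [← sq_abs t]; ring
      _ ≤ 1 ^ 3 * 1 * |t| := by gcongr
      _ ≤ 9 * |t| := by linarith [abs_nonneg t]
  · calc (2 * t * b ^ 2 - 4 * t ^ 3 * b ^ 3) ^ 2
        = (t ^ 2 * b) * (2 - 4 * (t ^ 2 * b)) ^ 2 * b ^ 2 * b := by ring
      _ = (1 - b) * (4 * b - 2) ^ 2 * b ^ 2 * b := by rw [htb]; ring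
      _ ≤ 1 * 2 ^ 2 * 1 ^ 2 * b := by
          gcongr ?_ * ?_ * ?_ ^ 2 * b
          · linarith
          · exact sq_le_sq.2 (by rw [abs_le, abs_of_pos two_pos]; constructor <;> linarith)
      _ ≤ 9 * b := by linarith

lemma setIntegral_norm_sq_fourierInv_dilSymbol_pow_one_le {f h : 𝓢(ℝ, ℂ)}
    (hode : ∀ ξ : ℝ, h ξ = Complex.I / (2 * π) * deriv f ξ + 12 * π ^ 2 * ξ ^ 2 * f ξ)
    (hf : ∀ ξ, ‖f ξ‖ ≤ 8) (hh : ∫ ξ : ℝ, |ξ| * ‖h ξ‖ ^ 2 ≤ 1)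
    {N : ℝ} (hN : 1 ≤ N) {A : Set ℝ} (hAm : MeasurableSet A) (hA : ∀ x ∈ A, |x| ≤ 2 * N ^ 2) :
    ∫ x in A, ‖𝓕⁻ (dilSymbol N (fun t => t ^ 1) f) x‖ ^ 2 ≤ 50000 * N := by
  have hb := hasTemperateGrowth_inv_one_add_sq
  have hσ : Function.HasTemperateGrowth fun t : ℝ => t * (1 + t ^ 2)⁻¹ := by fun_prop
  have hσ' : Function.HasTemperateGrowth fun t : ℝ =>
      (1 + t ^ 2)⁻¹ - 2 * t ^ 2 * (1 + t ^ 2)⁻¹ ^ 2 := by fun_prop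
  have hd (t : ℝ) := (hasDerivAt_id t).mul (hasDerivAt_inv_one_add_sq t)
  have key := setIntegral_norm_sq_fourierInv_dilSymbol_le hode hf hh hN hAm hA hσ hσ hσ'
    (fun t => (hd t).congr_deriv ?_) mul_inv_one_add_sq_sq_le (fun t => ?_) (fun t => ?_)
    ((setIntegral_norm_sq_fourierInv_le A _).trans
      (integral_norm_sq_dilSymbol_le hf hN hσ mul_inv_one_add_sq_sq_le))
  · have : (fun t : ℝ => t * (1 + t ^ 2)⁻¹ + t ^ 2 * (t * (1 + t ^ 2)⁻¹)) = fun t => t ^ 1 := by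
      ext t
      field_simp
    rw [this] at key
    linarith
  · simp [-inv_pow]
    generalize (1 + t ^ 2)⁻¹ = b
    ring
  all_goals
    obtain ⟨b, hb, hb0, hb1, htb, htb'⟩ := exists_inv_one_add_sq t
    rw [hb]
  · calc (t * b) ^ 2 = (|t| * b) * b * |t| := by rw [mul_pow, ← sq_abs t]; ring
      _ ≤ 1 * 1 * |t| := by gcongr
      _ ≤ 9 * |t| := by linarith [abs_nonneg t]
  · calc (b - 2 * t ^ 2 * b ^ 2) ^ 2 = (1 - 2 * (t ^ 2 * b)) ^ 2 * b * b := by ring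
      _ = (2 * b - 1) ^ 2 * b * b := by rw [htb]; ring
      _ ≤ 1 ^ 2 * 1 * b := by
          gcongr ?_ * ?_ * b
          · exact sq_le_sq.2 (by rw [abs_le, abs_of_pos one_pos]; constructor <;> linarith)
      _ ≤ 9 * b := by linarith

lemma setIntegral_norm_sq_fourierInv_dilSymbol_pow_two_le {f h : 𝓢(ℝ, ℂ)}
    (hode : ∀ ξ : ℝ, h ξ = Complex.I / (2 * π) * deriv f ξ + 12 * π ^ 2 * ξ ^ 2 * f ξ)
    (hf : ∀ ξ, ‖f ξ‖ ≤ 8) (hh : ∫ ξ : ℝ, |ξ| * ‖h ξ‖ ^ 2 ≤ 1)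
    {N : ℝ} (hN : 1 ≤ N) {A : Set ℝ} (hAm : MeasurableSet A) (hA : ∀ x ∈ A, |x| ≤ 2 * N ^ 2) :
    ∫ x in A, ‖𝓕⁻ (dilSymbol N (fun t => t ^ 2) f) x‖ ^ 2 ≤ 1700000 * N := by
  have hb := hasTemperateGrowth_inv_one_add_sq
  have hα : Function.HasTemperateGrowth fun t : ℝ => t ^ 2 * (1 + t ^ 2)⁻¹ ^ 2 := by fun_prop
  have hb2 : Function.HasTemperateGrowth fun t : ℝ => (1 + t ^ 2)⁻¹ ^ 2 := by fun_prop
  have hσ : Function.HasTemperateGrowth fun t : ℝ => 1 - (1 + t ^ 2)⁻¹ ^ 2 := by fun_prop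
  have hσ' : Function.HasTemperateGrowth fun t : ℝ => 4 * t * (1 + t ^ 2)⁻¹ ^ 3 := by fun_prop
  have hd (t : ℝ) := ((hasDerivAt_inv_one_add_sq t).pow 2).const_sub 1
  have hK : ∫ x in A, ‖𝓕⁻ (dilSymbol N (fun t => 1 - (1 + t ^ 2)⁻¹ ^ 2) f) x‖ ^ 2 ≤
      104000 * N := by
    have hsplit : dilSymbol N (fun t => 1 - (1 + t ^ 2)⁻¹ ^ 2) f =
        dilSymbol N (fun t => t ^ 0) f - dilSymbol N (fun t => (1 + t ^ 2)⁻¹ ^ 2) f := by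
      ext ξ
      have h0 : dilSymbol N (fun t => t ^ 0) f ξ = _ := dilSymbol_apply (by fun_prop) N f ξ
      rw [sub_apply, h0, dilSymbol_apply hσ, dilSymbol_apply hb2]
      push_cast
      ring
    have h1 := setIntegral_norm_sq_fourierInv_dilSymbol_pow_zero_le hode hf hh hN hAm hA
    have h2 := (setIntegral_norm_sq_fourierInv_le A _).trans
      (integral_norm_sq_dilSymbol_le hf hN hb2 fun t => by
        obtain ⟨b, hb, hb0, hb1, -⟩ := exists_inv_one_add_sq t
        rw [hb]
        calc (b ^ 2) ^ 2 = b ^ 3 * b := by ring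
          _ ≤ 1 ^ 3 * b := by gcongr
          _ ≤ 9 * b := by linarith)
    set g₁ := dilSymbol N (fun t => t ^ 0) f
    set g₂ := dilSymbol N (fun t => (1 + t ^ 2)⁻¹ ^ 2) f
    have i1 := (integrable_norm_sq_schwartz (𝓕⁻ g₁)).integrableOn (s := A)
    have i2 := (integrable_norm_sq_schwartz (𝓕⁻ g₂)).integrableOn (s := A)
    calc ∫ x in A, ‖𝓕⁻ (dilSymbol N (fun t => 1 - (1 + t ^ 2)⁻¹ ^ 2) f) x‖ ^ 2
        ≤ ∫ x in A, (2 * ‖𝓕⁻ g₁ x‖ ^ 2 + 2 * ‖𝓕⁻ g₂ x‖ ^ 2) := by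
          refine integral_mono (integrable_norm_sq_schwartz _).integrableOn
            ((i1.const_mul 2).add (i2.const_mul 2)) fun x => ?_
          rw [hsplit, sub_eq_add_neg, FourierTransform.fourierInv_add,
            FourierTransform.fourierInv_neg]
          have := norm_sub_le (𝓕⁻ g₁ x) (𝓕⁻ g₂ x)
          calc ‖(𝓕⁻ g₁ + -𝓕⁻ g₂) x‖ ^ 2 = ‖𝓕⁻ g₁ x - 𝓕⁻ g₂ x‖ ^ 2 := by
                rw [← sub_eq_add_neg, sub_apply]
            _ ≤ (‖𝓕⁻ g₁ x‖ + ‖𝓕⁻ g₂ x‖) ^ 2 := by gcongr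
            _ ≤ _ := by nlinarith [sq_nonneg (‖𝓕⁻ g₁ x‖ - ‖𝓕⁻ g₂ x‖)]
      _ = 2 * (∫ x in A, ‖𝓕⁻ g₁ x‖ ^ 2) + 2 * ∫ x in A, ‖𝓕⁻ g₂ x‖ ^ 2 := by
          rw [integral_add (i1.const_mul 2) (i2.const_mul 2), integral_const_mul,
            integral_const_mul]
      _ ≤ 104000 * N := by linarith
  have key := setIntegral_norm_sq_fourierInv_dilSymbol_le hode hf hh hN hAm hA hα hσ hσ'
    (fun t => (hd t).congr_deriv ?_) mul_inv_one_add_sq_sq_sq_le (fun t => ?_) (fun t => ?_) hK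
  · have : (fun t : ℝ => t ^ 2 * (1 + t ^ 2)⁻¹ ^ 2 + t ^ 2 * (1 - (1 + t ^ 2)⁻¹ ^ 2)) =
        fun t => t ^ 2 := by
      ext t
      ring
    rw [this] at key
    linarith
  · simp [-inv_pow]
    generalize (1 + t ^ 2)⁻¹ = b
    ring
  all_goals
    obtain ⟨b, hb, hb0, hb1, htb, htb'⟩ := exists_inv_one_add_sq t
    rw [hb]
  · calc (1 - b ^ 2) ^ 2 = ((1 - b) * (1 + b)) ^ 2 := by ring
      _ = (|t| * b) * (t ^ 2 * b) * (1 + b) ^ 2 * |t| := by rw [← htb, ← sq_abs t]; ring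
      _ ≤ 1 * 1 * (1 + 1) ^ 2 * |t| := by
          gcongr
          linarith
      _ ≤ 9 * |t| := by linarith [abs_nonneg t]
  · calc (4 * t * b ^ 3) ^ 2 = 16 * ((t ^ 2 * b) * b) * b ^ 3 * b := by ring
      _ ≤ 16 * (1 / 4) * 1 ^ 3 * b := by
          gcongr
          rw [htb]
          nlinarith [sq_nonneg (2 * b - 1)]
      _ ≤ 9 * b := by linarith

lemma hsNorm_nonneg (s : ℝ) (u : ℝ → ℝ) : 0 ≤ HsNorm s u :=
  Real.rpow_nonneg (integral_nonneg fun _ => by positivity) _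

lemma besovNorm_nonneg (u : ℝ → ℝ) : 0 ≤ BesovNorm u :=
  Real.iSup_nonneg fun _ => mul_nonneg (by positivity)
    (Real.rpow_nonneg (integral_nonneg fun _ => by positivity) _)

lemma rpow_neg_half_mul_rpow_half (j : ℤ) (X : ℝ) :
    (2 : ℝ) ^ (-(j : ℝ) / 2) * X ^ (1 / 2 : ℝ) = √(((2 : ℝ) ^ j)⁻¹ * X) := by
  rw [Real.sqrt_mul (by positivity), ← Real.sqrt_eq_rpow, Real.sqrt_eq_rpow (_⁻¹),
    ← Real.rpow_intCast, ← Real.rpow_neg two_pos.le, ← Real.rpow_mul two_pos.le]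
  congr 2
  ring

lemma setIntegral_dyadic_norm_sq_le {g : 𝓢(ℝ, ℂ)} {M : ℝ} (hM : ∀ ξ, ‖g ξ‖ ≤ M) (j : ℤ) :
    ∫ ξ in {ξ : ℝ | (2 : ℝ) ^ j ≤ |ξ| ∧ |ξ| < (2 : ℝ) ^ (j + 1)}, ‖g ξ‖ ^ 2 ≤
      4 * M ^ 2 * (2 : ℝ) ^ j := by
  have hsub : {ξ : ℝ | (2 : ℝ) ^ j ≤ |ξ| ∧ |ξ| < (2 : ℝ) ^ (j + 1)} ⊆
      Icc (-(2 : ℝ) ^ (j + 1)) ((2 : ℝ) ^ (j + 1)) := fun ξ hξ => abs_le.1 hξ.2.le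
  have hi := integrable_norm_sq_schwartz g
  have h2 : (0 : ℝ) < 2 ^ j := by positivity
  calc ∫ ξ in {ξ : ℝ | (2 : ℝ) ^ j ≤ |ξ| ∧ |ξ| < (2 : ℝ) ^ (j + 1)}, ‖g ξ‖ ^ 2
      ≤ ∫ ξ in Icc (-(2 : ℝ) ^ (j + 1)) ((2 : ℝ) ^ (j + 1)), ‖g ξ‖ ^ 2 :=
        setIntegral_mono_set hi.integrableOn (ae_of_all _ fun _ => by positivity)
          hsub.eventuallyLE
    _ ≤ ∫ ξ in Icc (-(2 : ℝ) ^ (j + 1)) ((2 : ℝ) ^ (j + 1)), M ^ 2 :=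
        integral_mono hi.integrableOn (by simp) fun ξ => by gcongr; exact hM ξ
    _ = 4 * M ^ 2 * (2 : ℝ) ^ j := by
        rw [setIntegral_const, measureReal_def, Real.volume_Icc, ENNReal.toReal_ofReal
          (by linarith [show (0 : ℝ) < 2 ^ (j + 1) by positivity]), zpow_add_one₀ two_ne_zero,
          smul_eq_mul]
        ring

lemma setIntegral_dyadic_le_of_besovNorm_le {u : 𝓢(ℝ, ℝ)} (hu : BesovNorm u ≤ 1) (j : ℤ) :
    ∫ ξ in {ξ : ℝ | (2 : ℝ) ^ j ≤ |ξ| ∧ |ξ| < (2 : ℝ) ^ (j + 1)},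
      ‖(𝓕 (cplx u) : 𝓢(ℝ, ℂ)) ξ‖ ^ 2 ≤ (2 : ℝ) ^ j := by
  have hbdd : BddAbove (range fun j : ℤ => (2 : ℝ) ^ (-(j : ℝ) / 2) *
      (∫ ξ in {ξ : ℝ | (2 : ℝ) ^ j ≤ |ξ| ∧ |ξ| < (2 : ℝ) ^ (j + 1)}, ‖FT u ξ‖ ^ 2) ^
        (1 / 2 : ℝ)) := by
    obtain ⟨M, hM⟩ : ∃ M, ∀ ξ, ‖(𝓕 (cplx u) : 𝓢(ℝ, ℂ)) ξ‖ ≤ M :=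
      ⟨_, fun ξ => norm_le_seminorm ℝ _ ξ⟩
    refine ⟨√(4 * M ^ 2), ?_⟩
    rintro _ ⟨j, rfl⟩
    simp only [FT_eq_fourier_cplx]
    rw [rpow_neg_half_mul_rpow_half j]
    refine Real.sqrt_le_sqrt ?_
    rw [inv_mul_le_iff₀ (by positivity), mul_comm]
    exact setIntegral_dyadic_norm_sq_le hM j
  have h1 := (le_ciSup hbdd j).trans hu
  simp only [FT_eq_fourier_cplx] at h1
  rw [rpow_neg_half_mul_rpow_half j, Real.sqrt_le_one,
    inv_mul_le_iff₀ (by positivity), mul_one] at h1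
  exact h1

lemma integral_abs_mul_norm_sq_le_of_hsNorm_le {u : 𝓢(ℝ, ℝ)} (hu : HsNorm (1 / 2) (Lop u) ≤ 1) :
    ∫ ξ : ℝ, |ξ| * ‖(𝓕 (cplxLop u) : 𝓢(ℝ, ℂ)) ξ‖ ^ 2 ≤ 1 := by
  rw [HsNorm, FT_Lop_eq_fourier_cplxLop, ← Real.sqrt_eq_rpow, Real.sqrt_le_one] at hu
  simpa using hu

lemma measurableSet_AR (R : ℝ) : MeasurableSet (AR R) :=
  have h : Measurable fun x : ℝ => (x ^ 2 + 1) ^ ((1 : ℝ) / 2) := by fun_prop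
  (measurableSet_le measurable_const h).inter (measurableSet_le h measurable_const)

lemma abs_le_of_mem_AR {R x : ℝ} (hx : x ∈ AR R) : |x| ≤ 2 * R := by
  refine le_trans ?_ hx.2
  rw [← Real.sqrt_eq_rpow]
  exact Real.abs_le_sqrt (by linarith)

lemma rpow_half_le_mul_rpow {X C R : ℝ} (hC : 0 ≤ C) (hR : 0 ≤ R) (k : ℕ)
    (hX : X ≤ C ^ 2 * √R ^ k) : X ^ (1 / 2 : ℝ) ≤ C * R ^ ((k : ℝ) / 4) := by
  rw [← Real.sqrt_eq_rpow]
  refine Real.sqrt_le_iff.2 ⟨by positivity, hX.trans_eq ?_⟩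
  rw [mul_pow, Real.sqrt_eq_rpow, ← Real.rpow_mul_natCast hR, ← Real.rpow_mul_natCast hR]
  congr 2
  push_cast
  ring

/-- Elliptic dyadic bounds: `‖u‖_{L²(A_R)} ≲ R^{1/4}`, `‖u'‖_{L²(A_R)} ≲ R^{3/4}`,
`‖u''‖_{L²(A_R)} ≲ R^{5/4}`. -/
theorem u_elliptic_dyadic_bounds :
    ∃ C : ℝ, 0 < C ∧ ∀ u : 𝓢(ℝ, ℝ),
      BesovNorm ⇑u + HsNorm ((1:ℝ)/2) (Lop ⇑u) ≤ 1 →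
      ∀ R : ℝ, 1 ≤ R →
        L2NormOn (AR R) ⇑u ≤ C * R ^ ((1:ℝ)/4) ∧
        L2NormOn (AR R) (deriv ⇑u) ≤ C * R ^ ((3:ℝ)/4) ∧
        L2NormOn (AR R) (iteratedDeriv 2 ⇑u) ≤ C * R ^ ((5:ℝ)/4) := by
  refine ⟨60000, by norm_num, fun u hu R hR => ?_⟩
  have hR0 : 0 ≤ R := by linarith
  have hN : 1 ≤ √R := Real.one_le_sqrt.2 hR
  have hN0 : √R ≠ 0 := by positivity
  have hA : ∀ x ∈ AR R, |x| ≤ 2 * √R ^ 2 := fun x hx => by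
    rw [Real.sq_sqrt hR0]
    exact abs_le_of_mem_AR hx
  have hode := fourier_cplxLop u
  have hh : ∫ ξ : ℝ, |ξ| * ‖(𝓕 (cplxLop u) : 𝓢(ℝ, ℂ)) ξ‖ ^ 2 ≤ 1 :=
    integral_abs_mul_norm_sq_le_of_hsNorm_le (by linarith [besovNorm_nonneg u])
  have hf : ∀ ξ, ‖(𝓕 (cplx u) : 𝓢(ℝ, ℂ)) ξ‖ ≤ 8 :=
    norm_le_of_dyadic hode hh
      (setIntegral_dyadic_le_of_besovNorm_le (by linarith [hsNorm_nonneg (1 / 2) (Lop u)]))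
  have h0 := setIntegral_norm_sq_fourierInv_dilSymbol_pow_zero_le hode hf hh hN
    (measurableSet_AR R) hA
  have h1 := setIntegral_norm_sq_fourierInv_dilSymbol_pow_one_le hode hf hh hN
    (measurableSet_AR R) hA
  have h2 := setIntegral_norm_sq_fourierInv_dilSymbol_pow_two_le hode hf hh hN
    (measurableSet_AR R) hA
  have d0 := fourierInv_dilSymbol_pow_zero √R (cplx u)
  have d1 := lineDerivOp_one_fourierInv_dilSymbol_pow hN0 0 (𝓕 (cplx u))
  have d2 := lineDerivOp_one_fourierInv_dilSymbol_pow hN0 1 (𝓕 (cplx u))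
  rw [d0, lineDerivOp_one_cplx, zero_add] at d1
  have d1' := congrArg (fun g : 𝓢(ℝ, ℂ) => ∂_{(1 : ℝ)} g) d1
  simp only [lineDerivOp_one_cplx, lineDerivOp_smul, d2, one_add_one_eq_two] at d1'
  rw [d0, ← setIntegral_sq_eq_norm_cplx] at h0
  have hc : ‖(2 * π * Complex.I * √R : ℂ)‖ ^ 2 ≤ 40 * √R ^ 2 := by
    have : ‖(2 * π * Complex.I * √R : ℂ)‖ = 2 * π * √R := by
      simp [abs_of_pos Real.pi_pos]
    rw [this, mul_pow]
    gcongr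
    nlinarith [Real.pi_lt_d2, Real.pi_pos]
  have e1 : ∫ x in AR R, derivCLM ℝ ℝ u x ^ 2 ≤ 40 * √R ^ 2 * (50000 * √R) := by
    rw [setIntegral_sq_eq_norm_cplx, d1, setIntegral_norm_sq_smul]
    gcongr
  have e2 : ∫ x in AR R, derivCLM ℝ ℝ (derivCLM ℝ ℝ u) x ^ 2 ≤
      40 * √R ^ 2 * (40 * √R ^ 2 * (1700000 * √R)) := by
    rw [setIntegral_sq_eq_norm_cplx, d1', setIntegral_norm_sq_smul, setIntegral_norm_sq_smul]
    gcongr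
  have hu1 : deriv u = derivCLM ℝ ℝ u := funext fun x => (derivCLM_apply ℝ u x).symm
  rw [← coe_derivCLM_derivCLM, hu1]
  refine ⟨?_, ?_, ?_⟩
  · refine mod_cast rpow_half_le_mul_rpow (C := 60000) (by norm_num) hR0 1 (h0.trans ?_)
    rw [pow_one]
    gcongr
    norm_num
  · refine mod_cast rpow_half_le_mul_rpow (C := 60000) (by norm_num) hR0 3 (e1.trans ?_)
    nlinarith [show 0 ≤ √R ^ 3 by positivity]
  · refine mod_cast rpow_half_le_mul_rpow (C := 60000) (by norm_num) hR0 5 (e2.trans ?_)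
    nlinarith [show 0 ≤ √R ^ 5 by positivity]
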